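/- arXiv:2506.23498 — 7 statements merged into one kernel-verified Lean document; each statement's English description precedes it below -/
import Mathlib

section
/- Define c : ℕ → ℕ by c(k) := min{d ∈ ℕ : d² + 3d ≥ 2k} (the k-th ECH capacity of the unit ball B(1)). Then liminf_{k→∞} (c(k) − √(2k)) = −3/2 and limsup_{k→∞} (c(k) − √(2k)) = −1/2. -/
open Filter

/-- The `k`-th ECH capacity of the unit ball `B(1)`:
`c k = min {d ∈ ℕ | d² + 3d ≥ 2k}`. -/
noncomputable def ballCap (k : ℕ) : ℕ := sInf {d : ℕ | 2 * k ≤ d ^ 2 + 3 * d}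

theorem le_ballCap_sq (k : ℕ) : 2 * k ≤ ballCap k ^ 2 + 3 * ballCap k :=
  Nat.sInf_mem (s := {d : ℕ | 2 * k ≤ d ^ 2 + 3 * d}) ⟨k, by
    simp only [Set.mem_ofPred_eq]; nlinarith⟩

theorem ballCap_le {k d : ℕ} (h : 2 * k ≤ d ^ 2 + 3 * d) : ballCap k ≤ d :=
  Nat.sInf_le h

theorem ballCap_sq_le (k : ℕ) : ballCap k ^ 2 + ballCap k ≤ 2 * k := by
  rcases hn : ballCap k with _ | m
  · simp
  · have hm : ¬ 2 * k ≤ m ^ 2 + 3 * m := fun h => by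
      have := ballCap_le h
      omega
    obtain ⟨r, hr⟩ := Nat.even_mul_succ_self m
    have h1 : m ^ 2 + m = r + r := by rw [← hr]; ring
    have h2 : (m + 1) ^ 2 + (m + 1) = m ^ 2 + 3 * m + 2 := by ring
    omega

theorem ballCap_eq {k n : ℕ} (h₁ : n ^ 2 + n ≤ 2 * k) (h₂ : 2 * k ≤ n ^ 2 + 3 * n) :
    ballCap k = n := by
  refine le_antisymm (ballCap_le h₂) ?_
  by_contra! h
  have := le_ballCap_sq k
  nlinarith

theorem tendsto_ballCap : Tendsto ballCap atTop atTop := by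
  refine tendsto_atTop.2 fun b => ?_
  filter_upwards [eventually_ge_atTop (b ^ 2 + 3 * b)] with k hk
  by_contra! h
  have := le_ballCap_sq k
  nlinarith

theorem tendsto_sub_sqrt_sq_add_mul {a : ℝ} (ha : 0 ≤ a) :
    Tendsto (fun n : ℕ => (n : ℝ) - √((n : ℝ) ^ 2 + a * n)) atTop (nhds (-(a / 2))) := by
  have h1 : Tendsto (fun n : ℕ => -(a / (1 + √(1 + a / (n : ℝ))))) atTop
      (nhds (-(a / (1 + √(1 + 0))))) :=
    (tendsto_const_nhds.div
      (((tendsto_const_div_atTop_nhds_zero_nat a).const_add 1).sqrt.const_add 1)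
      (by positivity)).neg
  have h2 : (1 : ℝ) + √(1 + 0) = 2 := by norm_num
  rw [h2] at h1
  refine h1.congr' ?_
  filter_upwards [eventually_gt_atTop 0] with n hn
  have hn' : (0 : ℝ) < n := by exact_mod_cast hn
  have h3 : (n : ℝ) ^ 2 + a * n = (n : ℝ) ^ 2 * (1 + a / n) := by field_simp
  rw [h3, Real.sqrt_mul (by positivity), Real.sqrt_sq hn'.le]
  have h4 : √(1 + a / (n : ℝ)) ^ 2 = 1 + a / n := Real.sq_sqrt (by positivity)
  have h5 : a = n * (√(1 + a / (n : ℝ)) ^ 2 - 1) := by rw [h4]; field_simp; ring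
  have h6 : (0 : ℝ) < 1 + √(1 + a / (n : ℝ)) := by positivity
  rw [neg_eq_iff_eq_neg, div_eq_iff h6.ne']
  linear_combination h5

theorem limsup_eq_of_le_of_tendsto_comp {f G : ℕ → ℝ} {φ : ℕ → ℕ} {L : ℝ}
    (hfG : ∀ k, f k ≤ G k) (hG : Tendsto G atTop (nhds L))
    (hφ : Tendsto φ atTop atTop) (hfφ : Tendsto (f ∘ φ) atTop (nhds L)) :
    limsup f atTop = L := by
  have hb : IsBoundedUnder (· ≤ ·) atTop f :=
    hG.isBoundedUnder_le.mono_le (Eventually.of_forall hfG)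
  have hc : IsCoboundedUnder (· ≤ ·) (map φ atTop) f :=
    hfφ.isCoboundedUnder_le
  refine le_antisymm ?_ ?_
  · rw [← hG.limsup_eq]
    exact limsup_le_limsup (Eventually.of_forall hfG) (hc.mono (map_mono hφ))
      hG.isBoundedUnder_le
  · rw [← hfφ.limsup_eq]
    exact limsup_le_limsup_of_le hφ hc hb

theorem liminf_eq_of_le_of_tendsto_comp {f G : ℕ → ℝ} {φ : ℕ → ℕ} {L : ℝ}
    (hGf : ∀ k, G k ≤ f k) (hG : Tendsto G atTop (nhds L))
    (hφ : Tendsto φ atTop atTop) (hfφ : Tendsto (f ∘ φ) atTop (nhds L)) :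
    liminf f atTop = L := by
  have hb : IsBoundedUnder (· ≥ ·) atTop f :=
    hG.isBoundedUnder_ge.mono_ge (Eventually.of_forall hGf)
  have hc : IsCoboundedUnder (· ≥ ·) (map φ atTop) f :=
    hfφ.isCoboundedUnder_ge
  refine le_antisymm ?_ ?_
  · rw [← hfφ.liminf_eq]
    exact liminf_le_liminf_of_le hφ hb hc
  · rw [← hG.liminf_eq]
    exact liminf_le_liminf (Eventually.of_forall hGf) hG.isBoundedUnder_ge
      (hc.mono (map_mono hφ))

/-- `liminf (c k − √(2k)) = −3/2` and `limsup (c k − √(2k)) = −1/2`. -/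
theorem stmt_2 :
    Filter.liminf (fun k : ℕ => (ballCap k : ℝ) - Real.sqrt (2 * k)) Filter.atTop
        = -(3 / 2 : ℝ) ∧
    Filter.limsup (fun k : ℕ => (ballCap k : ℝ) - Real.sqrt (2 * k)) Filter.atTop
        = -(1 / 2 : ℝ) := by
  have h3 := tendsto_sub_sqrt_sq_add_mul (a := 3) (by norm_num)
  have h1 := tendsto_sub_sqrt_sq_add_mul (a := 1) (by norm_num)
  have e3 (n : ℕ) : 2 * (n * (n + 3) / 2) = n ^ 2 + 3 * n := by
    rw [Nat.mul_div_cancel' (even_iff_two_dvd.1 (by grind))]; ring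
  have e1 (n : ℕ) : 2 * (n * (n + 1) / 2) = n ^ 2 + n := by
    rw [Nat.mul_div_cancel' (even_iff_two_dvd.1 (Nat.even_mul_succ_self n))]; ring
  constructor
  · refine liminf_eq_of_le_of_tendsto_comp (φ := fun n => n * (n + 3) / 2) (fun k => ?_)
      (h3.comp tendsto_ballCap) ?_ (h3.congr fun n => ?_)
    · have : (2 * k : ℝ) ≤ (ballCap k : ℝ) ^ 2 + 3 * ballCap k := by
        exact_mod_cast le_ballCap_sq k
      exact sub_le_sub_left (Real.sqrt_le_sqrt this) _
    · refine tendsto_atTop_mono (fun n => ?_) tendsto_id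
      have := e3 n
      simp only [id]
      omega
    · have : (2 * (n * (n + 3) / 2 : ℕ) : ℝ) = (n : ℝ) ^ 2 + 3 * n := by exact_mod_cast e3 n
      simp only [Function.comp_apply]
      rw [this, ballCap_eq (n := n) (by rw [e3]; omega) (e3 n).le]
  · refine limsup_eq_of_le_of_tendsto_comp (φ := fun n => n * (n + 1) / 2) (fun k => ?_)
      (h1.comp tendsto_ballCap) ?_ (h1.congr fun n => ?_)
    · have : (ballCap k : ℝ) ^ 2 + 1 * ballCap k ≤ 2 * k := by
        rw [one_mul]; exact_mod_cast ballCap_sq_le k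
      exact sub_le_sub_left (Real.sqrt_le_sqrt this) _
    · refine tendsto_atTop_mono (fun n => ?_) tendsto_id
      have := e1 n
      have := Nat.le_self_pow two_ne_zero n
      simp only [id]
      omega
    · have : (2 * (n * (n + 1) / 2 : ℕ) : ℝ) = (n : ℝ) ^ 2 + 1 * n := by
        rw [one_mul]; exact_mod_cast e1 n
      simp only [Function.comp_apply]
      rw [this, ballCap_eq (n := n) (e1 n).ge (by rw [e1]; omega)]
end

section
/- Let b > 0 and let (b_j)_{j≥1} be a nonincreasing summable sequence of nonnegative reals with b_1 + b_2 ≤ b, ∑_j b_j ≤ 3b and ∑_j b_j² < b². Define cB(a,k) := a · min{d ∈ ℕ : d² + 3d ≥ 2k} for a ≥ 0 and k ∈ ℕ, and define c_k := inf over finitely supported functions κ : ℕ → ℕ of [cB(b, k + ∑_j κ(j)) − ∑_j cB(b_j, κ(j))]. Set Vol := b² − ∑_j b_j² and Per := 3b − ∑_j b_j. Then liminf_{k→∞} (c_k − √(2k·Vol)) = −Per/2. -/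
open Filter

/-- The `k`-th ECH capacity of the ball `B(a)`: `cB a k = a * min {d ∈ ℕ | d² + 3d ≥ 2k}`. -/
noncomputable def cB (a : ℝ) (k : ℕ) : ℝ :=
  a * (sInf {d : ℕ | 2 * k ≤ d ^ 2 + 3 * d} : ℕ)

/-- The `k`-th ECH capacity of the convex toric domain with negative weight data
`(b; (bj j))`: the infimum over finitely supported `κ : ℕ → ℕ` of
`cB b (k + ∑ κ j) − ∑ cB (bj j) (κ j)`. -/
noncomputable def toricCap (b : ℝ) (bj : ℕ → ℝ) (k : ℕ) : ℝ :=
  ⨅ κ : ℕ →₀ ℕ,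
    (cB b (k + ∑ j ∈ κ.support, κ j) - ∑ j ∈ κ.support, cB (bj j) (κ j))

/-- The least `d` with `d² + 3d ≥ 2k`, so that `cB a k = a * ballDegree k`. -/
noncomputable def ballDegree (k : ℕ) : ℕ := sInf {d : ℕ | 2 * k ≤ d ^ 2 + 3 * d}

theorem cB_eq (a : ℝ) (k : ℕ) : cB a k = a * (ballDegree k : ℝ) := rfl

theorem ballDegree_spec (k : ℕ) : 2 * k ≤ ballDegree k ^ 2 + 3 * ballDegree k :=
  Nat.sInf_mem (s := {d : ℕ | 2 * k ≤ d ^ 2 + 3 * d})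
    ⟨k, by simp only [Set.mem_ofPred_eq]; nlinarith⟩

theorem ballDegree_le {k d : ℕ} (h : 2 * k ≤ d ^ 2 + 3 * d) : ballDegree k ≤ d :=
  Nat.sInf_le h

theorem ballDegree_zero : ballDegree 0 = 0 :=
  Nat.le_zero.1 (ballDegree_le (by simp))

theorem even_sq_add_self (m : ℕ) : Even (m ^ 2 + m) := by
  rw [sq]
  exact Nat.even_mul_succ_self m

theorem cB_zero (a : ℝ) : cB a 0 = 0 := by simp [cB_eq, ballDegree_zero]

theorem ballDegree_sq_add_le (k : ℕ) : ballDegree k ^ 2 + ballDegree k ≤ 2 * k := by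
  rcases h : ballDegree k with _ | e
  · simp
  · have h1 : ¬ 2 * k ≤ e ^ 2 + 3 * e := fun h2 => by
      have := ballDegree_le h2
      omega
    obtain ⟨r, hr⟩ := even_sq_add_self (e + 1)
    have h3 : (e + 1) ^ 2 + (e + 1) = e ^ 2 + 3 * e + 2 := by ring
    omega

theorem le_ballDegree {k e : ℕ} (h : e ^ 2 + e ≤ 2 * k) : e ≤ ballDegree k := by
  have := ballDegree_spec k
  by_contra! hlt
  nlinarith

/-- The reverse Cauchy–Schwarz inequality in Lorentzian signature. -/
theorem sqrt_mul_le_sub_sum {ι : Type*} (S : Finset ι) (f g : ι → ℝ) {b X v z : ℝ}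
    (hb : 0 ≤ b) (hX : 0 ≤ X) (hv : 0 ≤ v) (hz : 0 ≤ z)
    (hf : v + ∑ j ∈ S, f j ^ 2 ≤ b ^ 2) (hg : z + ∑ j ∈ S, g j ^ 2 ≤ X ^ 2) :
    √(v * z) ≤ b * X - ∑ j ∈ S, f j * g j := by
  have hcs := Real.sum_mul_le_sqrt_mul_sqrt S f g
  have hp := Real.sqrt_nonneg (∑ j ∈ S, f j ^ 2)
  have hq := Real.sqrt_nonneg (∑ j ∈ S, g j ^ 2)
  have hp2 := Real.sq_sqrt (Finset.sum_nonneg fun j (_ : j ∈ S) => sq_nonneg (f j))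
  have hq2 := Real.sq_sqrt (Finset.sum_nonneg fun j (_ : j ∈ S) => sq_nonneg (g j))
  set p := √(∑ j ∈ S, f j ^ 2)
  set q := √(∑ j ∈ S, g j ^ 2)
  have hpb : p ≤ b := abs_le_of_sq_le_sq' (by linarith) hb |>.2
  have hqX : q ≤ X := abs_le_of_sq_le_sq' (by linarith) hX |>.2
  have hpq : p * q ≤ b * X := mul_le_mul hpb hqX hq hb
  refine le_trans ?_ (sub_le_sub_left hcs _)
  apply Real.sqrt_le_iff.2 ⟨by linarith, ?_⟩
  have h1 : v * z ≤ (b ^ 2 - p ^ 2) * (X ^ 2 - q ^ 2) :=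
    mul_le_mul (by linarith) (by linarith) hz (by linarith)
  nlinarith [sq_nonneg (b * q - p * X)]

theorem summable_sq_of_antitone {f : ℕ → ℝ} (h0 : ∀ j, 0 ≤ f j) (hmono : Antitone f)
    (hsum : Summable f) : Summable fun j => f j ^ 2 :=
  Summable.of_nonneg_of_le (fun j => sq_nonneg _)
    (fun j => by nlinarith [h0 j, hmono (Nat.zero_le j)]) (hsum.mul_left (f 0))

theorem toricCap_term_ge {b : ℝ} (hb : 0 < b) {bj : ℕ → ℝ}
    (hs2 : Summable fun j => bj j ^ 2) (hsq : ∑' j, bj j ^ 2 < b ^ 2)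
    {k N : ℕ} (hN : N ≤ 8 * k + 9) (κ : ℕ →₀ ℕ) :
    √((b ^ 2 - ∑' j, bj j ^ 2) * (2 * k + 9 / 4 - N / 4))
        - (3 * b - ∑ j ∈ Finset.range N, bj j) / 2 ≤
      cB b (k + ∑ j ∈ κ.support, κ j) - ∑ j ∈ κ.support, cB (bj j) (κ j) := by
  classical
  set S := Finset.range N ∪ κ.support
  have hsub : κ.support ⊆ S := Finset.subset_union_right
  have e1 : ∑ j ∈ κ.support, κ j = ∑ j ∈ S, κ j :=
    Finset.sum_subset hsub fun j _ hj => Finsupp.notMem_support_iff.1 hj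
  have e2 : ∑ j ∈ κ.support, cB (bj j) (κ j) = ∑ j ∈ S, cB (bj j) (κ j) :=
    Finset.sum_subset hsub fun j _ hj => by
      rw [Finsupp.notMem_support_iff.1 hj, cB_zero]
  rw [e1, e2]
  have hind (f : ℕ → ℝ) :
      ∑ j ∈ S, (if j ∈ Finset.range N then f j else 0) = ∑ j ∈ Finset.range N, f j := by
    rw [← Finset.sum_filter, Finset.filter_mem_eq_inter,
      Finset.inter_eq_right.2 Finset.subset_union_left]
  set D := ballDegree (k + ∑ j ∈ S, κ j) with hD
  have hD1 : 2 * ((k : ℝ) + ∑ j ∈ S, (κ j : ℝ)) ≤ (D : ℝ) ^ 2 + 3 * D := by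
    exact_mod_cast ballDegree_spec (k + ∑ j ∈ S, κ j)
  have hE (j : ℕ) : (ballDegree (κ j) : ℝ) ^ 2 + ballDegree (κ j) ≤ 2 * κ j := by
    exact_mod_cast ballDegree_sq_add_le (κ j)
  have hNr : (N : ℝ) ≤ 8 * k + 9 := by exact_mod_cast hN
  have hle : ∑ j ∈ S, bj j ^ 2 ≤ ∑' j, bj j ^ 2 :=
    hs2.sum_le_tsum S fun j _ => sq_nonneg _
  have hg : ∑ j ∈ S, ((ballDegree (κ j) : ℝ) + if j ∈ Finset.range N then 1 / 2 else 0) ^ 2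
      ≤ 2 * ∑ j ∈ S, (κ j : ℝ) + N / 4 := by
    have h2 : (N : ℝ) / 4 = ∑ j ∈ S, if j ∈ Finset.range N then (1 / 4 : ℝ) else 0 := by
      rw [hind]; simp; ring
    rw [h2, Finset.mul_sum, ← Finset.sum_add_distrib]
    refine Finset.sum_le_sum fun j _ => ?_
    have := hE j
    have h0 : (0 : ℝ) ≤ ballDegree (κ j) := Nat.cast_nonneg _
    split_ifs <;> nlinarith
  have key := sqrt_mul_le_sub_sum S bj
    (fun j => (ballDegree (κ j) : ℝ) + if j ∈ Finset.range N then 1 / 2 else 0)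
    (b := b) (X := D + 3 / 2) (v := b ^ 2 - ∑' j, bj j ^ 2) (z := 2 * k + 9 / 4 - N / 4)
    hb.le (by positivity) (by linarith) (by linarith) (by linarith) (by
      nlinarith)
  have hsplit : ∑ j ∈ S, bj j *
      ((ballDegree (κ j) : ℝ) + if j ∈ Finset.range N then 1 / 2 else 0) =
      ∑ j ∈ S, cB (bj j) (κ j) + (∑ j ∈ Finset.range N, bj j) / 2 := by
    rw [Finset.sum_div, ← hind, ← Finset.sum_add_distrib]
    refine Finset.sum_congr rfl fun j _ => ?_
    rw [cB_eq]
    split_ifs <;> ring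
  rw [hsplit] at key
  rw [cB_eq b, ← hD]
  linarith

theorem toricCap_ge {b : ℝ} (hb : 0 < b) {bj : ℕ → ℝ}
    (hs2 : Summable fun j => bj j ^ 2) (hsq : ∑' j, bj j ^ 2 < b ^ 2)
    {k N : ℕ} (hN : N ≤ 8 * k + 9) :
    √((b ^ 2 - ∑' j, bj j ^ 2) * (2 * k + 9 / 4 - N / 4))
        - (3 * b - ∑ j ∈ Finset.range N, bj j) / 2 ≤ toricCap b bj k :=
  le_ciInf fun κ => toricCap_term_ge hb hs2 hsq hN κ

theorem toricCap_le {b : ℝ} (hb : 0 < b) {bj : ℕ → ℝ}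
    (hs2 : Summable fun j => bj j ^ 2) (hsq : ∑' j, bj j ^ 2 < b ^ 2)
    (k : ℕ) (κ : ℕ →₀ ℕ) :
    toricCap b bj k ≤
      cB b (k + ∑ j ∈ κ.support, κ j) - ∑ j ∈ κ.support, cB (bj j) (κ j) :=
  ciInf_le ⟨_, Set.forall_mem_range.2 fun κ =>
    toricCap_term_ge hb hs2 hsq (k := k) (N := 0) (Nat.zero_le _) κ⟩ κ

/-- The capacity is at most the value attained by a degree vector `(n; (e j))`. -/
theorem toricCap_le_of_degrees {b : ℝ} (hb : 0 < b) {bj : ℕ → ℝ} (hnonneg : ∀ j, 0 ≤ bj j)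
    (hs2 : Summable fun j => bj j ^ 2) (hsq : ∑' j, bj j ^ 2 < b ^ 2)
    {k n : ℕ} (F : Finset ℕ) (e : ℕ → ℕ) (he : ∀ j, j ∉ F → e j = 0)
    (hk : 2 * k + ∑ j ∈ F, (e j ^ 2 + e j) ≤ n ^ 2 + 3 * n) :
    toricCap b bj k ≤ b * n - ∑ j ∈ F, bj j * e j := by
  have hdiv (j : ℕ) : 2 * ((e j ^ 2 + e j) / 2) = e j ^ 2 + e j :=
    Nat.two_mul_div_two_of_even (even_sq_add_self _)
  let κ : ℕ →₀ ℕ := Finsupp.onFinset F (fun j => (e j ^ 2 + e j) / 2) fun j hj => by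
    by_contra h
    simp [he j h] at hj
  have hκ (j : ℕ) : κ j = (e j ^ 2 + e j) / 2 := rfl
  have hsub : κ.support ⊆ F := Finsupp.support_onFinset_subset
  refine (toricCap_le hb hs2 hsq k κ).trans ?_
  have e1 : ∑ j ∈ κ.support, κ j = ∑ j ∈ F, κ j :=
    Finset.sum_subset hsub fun j _ hj => Finsupp.notMem_support_iff.1 hj
  have e2 : ∑ j ∈ κ.support, cB (bj j) (κ j) = ∑ j ∈ F, cB (bj j) (κ j) :=
    Finset.sum_subset hsub fun j _ hj => by
      rw [Finsupp.notMem_support_iff.1 hj, cB_zero]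
  rw [e1, e2]
  refine sub_le_sub ?_ (Finset.sum_le_sum fun j _ => ?_)
  · rw [cB_eq]
    refine mul_le_mul_of_nonneg_left (Nat.cast_le.2 (ballDegree_le ?_)) hb.le
    rw [mul_add, Finset.mul_sum]
    simpa only [hκ, hdiv] using hk
  · rw [cB_eq]
    exact mul_le_mul_of_nonneg_left
      (Nat.cast_le.2 (le_ballDegree (by rw [hκ, hdiv]))) (hnonneg j)

/-- Second order lower bound for the square root of `v * (t ^ 2 * v + D)`. -/
theorem sqrt_ge_of_bounds {v t D C : ℝ} (hv : 0 < v) (ht : 0 < t) (hD0 : 0 ≤ D)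
    (hDC : D ≤ 2 * t * C) :
    t * v + D / (2 * t) - C ^ 2 / (2 * t * v) ≤ √(v * (t ^ 2 * v + D)) := by
  have hr2 : √(v * (t ^ 2 * v + D)) ^ 2 = v * (t ^ 2 * v + D) :=
    Real.sq_sqrt (by positivity)
  have hr0 := Real.sqrt_nonneg (v * (t ^ 2 * v + D))
  set r := √(v * (t ^ 2 * v + D))
  have hs : 0 < t * v := mul_pos ht hv
  have hrs : t * v ≤ r := abs_le_of_sq_le_sq' (by nlinarith) hr0 |>.2
  have hu : r - t * v ≤ C := by
    by_contra! h
    have h1 : v * D = (r - t * v) ^ 2 + 2 * (t * v) * (r - t * v) := by linarith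
    nlinarith [sq_nonneg (r - t * v), mul_le_mul_of_nonneg_left hDC hv.le,
      mul_lt_mul_of_pos_left h hs]
  have hu2 : (r - t * v) ^ 2 ≤ C ^ 2 := pow_le_pow_left₀ (by linarith) hu 2
  have heq : t * v + D / (2 * t) - C ^ 2 / (2 * t * v) =
      t * v + (v * D - C ^ 2) / (2 * (t * v)) := by
    field_simp
    ring
  have : (v * D - C ^ 2) / (2 * (t * v)) ≤ r - t * v := by
    rw [div_le_iff₀ (by positivity)]
    nlinarith
  linarith

theorem exists_toricCap_sub_sqrt_le {b : ℝ} (hb : 0 < b) {bj : ℕ → ℝ}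
    (hnonneg : ∀ j, 0 ≤ bj j) (hsum : Summable bj) (h3b : ∑' j, bj j ≤ 3 * b)
    (hs2 : Summable fun j => bj j ^ 2) (hsq : ∑' j, bj j ^ 2 < b ^ 2)
    {t : ℝ} (ht : 0 < t) {n : ℕ} (hn : (n : ℝ) = t * b) :
    ∃ k : ℕ, t ^ 2 * (b ^ 2 - ∑' j, bj j ^ 2) ≤ 2 * k ∧
      toricCap b bj k - √(2 * k * (b ^ 2 - ∑' j, bj j ^ 2)) ≤
        -(3 * b - ∑' j, bj j) / 2
          + (9 * b / 2) ^ 2 / (2 * t * (b ^ 2 - ∑' j, bj j ^ 2)) := by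
  set e : ℕ → ℕ := fun j => ⌊t * bj j⌋₊
  have hx0 (j : ℕ) : 0 ≤ t * bj j := mul_nonneg ht.le (hnonneg j)
  have hle (j : ℕ) : (e j : ℝ) ≤ t * bj j := Nat.floor_le (hx0 j)
  have hlt (j : ℕ) : t * bj j < e j + 1 := Nat.lt_floor_add_one _
  have he0 (j : ℕ) : (0 : ℝ) ≤ e j := Nat.cast_nonneg _
  obtain ⟨M, hM⟩ : ∃ M, ∀ j, M ≤ j → t * bj j < 1 := by
    have := (hsum.mul_left t).tendsto_atTop_zero
    exact eventually_atTop.1 (this.eventually (gt_mem_nhds one_pos))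
  set F := Finset.range M
  have heF (j : ℕ) (hj : j ∉ F) : e j = 0 :=
    Nat.floor_eq_zero.2 (hM j (by simpa [F] using hj))
  set A := ∑' j, bj j
  set B := ∑' j, bj j ^ 2
  set E₂ : ℝ := ∑ j ∈ F, ((e j : ℝ) ^ 2 + e j) with hE₂
  set E₁ : ℝ := ∑ j ∈ F, bj j * (e j : ℝ) with hE₁
  have hlin (α β : ℝ) : HasSum (fun j => α * bj j ^ 2 + β * bj j) (α * B + β * A) :=
    (hs2.hasSum.mul_left α).add (hsum.hasSum.mul_left β)
  have hsE (α : ℝ) : HasSum (fun j => (e j : ℝ) ^ 2 + e j - α * (bj j * e j)) (E₂ - α * E₁) := by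
    have : E₂ - α * E₁ = ∑ j ∈ F, ((e j : ℝ) ^ 2 + e j - α * (bj j * e j)) := by
      rw [hE₂, hE₁, Finset.sum_sub_distrib, Finset.mul_sum]
    rw [this]
    exact hasSum_sum_of_ne_finset_zero fun j hj => by simp [heF j hj]
  have hval : E₂ - 2 * t * E₁ ≤ -t ^ 2 * B + t * A :=
    hasSum_le (fun j => by
      nlinarith [mul_nonneg (sub_nonneg.2 (hle j)) (sub_nonneg.2 (hlt j).le)])
      (hsE (2 * t)) (hlin (-t ^ 2) t)
  have hup : E₂ - 0 * E₁ ≤ t ^ 2 * B + t * A :=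
    hasSum_le (fun j => by nlinarith [hle j, he0 j, hx0 j]) (hsE 0) (hlin (t ^ 2) t)
  have hlow : t ^ 2 * B + (-2 * t) * A ≤ E₂ - 0 * E₁ :=
    hasSum_le (fun j => by nlinarith [hle j, he0 j, hx0 j, hlt j]) (hlin (t ^ 2) (-2 * t)) (hsE 0)
  have htA : t * A ≤ 3 * n := by rw [hn]; nlinarith
  have hn2 : (n : ℝ) ^ 2 = t ^ 2 * b ^ 2 := by rw [hn]; ring
  have hE₂nat : E₂ = ((∑ j ∈ F, (e j ^ 2 + e j) : ℕ) : ℝ) := by push_cast; rfl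
  have hv : 0 < b ^ 2 - B := by linarith
  have hY0 : t ^ 2 * (b ^ 2 - B) ≤ n ^ 2 + 3 * n - E₂ := by nlinarith
  have hleN : ∑ j ∈ F, (e j ^ 2 + e j) ≤ n ^ 2 + 3 * n := by
    have : E₂ ≤ n ^ 2 + 3 * n := by nlinarith [mul_pos (pow_pos ht 2) hv]
    rw [hE₂nat] at this
    exact_mod_cast this
  have hev : Even (∑ j ∈ F, (e j ^ 2 + e j)) := Finset.even_sum _ fun j _ => even_sq_add_self _
  have hevn : Even (n ^ 2 + 3 * n) := by
    have h : n ^ 2 + 3 * n = n ^ 2 + n + 2 * n := by ring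
    rw [h]
    exact (even_sq_add_self n).add (even_two_mul n)
  obtain ⟨k, hk⟩ := (Nat.even_sub hleN).2 (iff_of_true hevn hev)
  have hk' : 2 * k + ∑ j ∈ F, (e j ^ 2 + e j) = n ^ 2 + 3 * n := by omega
  have hkr : 2 * (k : ℝ) = n ^ 2 + 3 * n - E₂ := by
    have : (2 * (k : ℝ)) + ((∑ j ∈ F, (e j ^ 2 + e j) : ℕ) : ℝ) = n ^ 2 + 3 * n := by
      exact_mod_cast hk'
    linarith
  refine ⟨k, by linarith, ?_⟩
  have hcap := toricCap_le_of_degrees hb hnonneg hs2 hsq F e heF hk'.le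
  have hsqrt := sqrt_ge_of_bounds (D := 2 * k - t ^ 2 * (b ^ 2 - B)) (C := 9 * b / 2) hv ht
    (by linarith) (by nlinarith)
  rw [add_sub_cancel, mul_comm (b ^ 2 - B)] at hsqrt
  have hmain : b * n - E₁ ≤ t * (b ^ 2 - B) + (2 * k - t ^ 2 * (b ^ 2 - B)) / (2 * t)
      - (3 * b - A) / 2 := by
    have : t * (b ^ 2 - B) + (2 * k - t ^ 2 * (b ^ 2 - B)) / (2 * t) - (3 * b - A) / 2 =
        (t ^ 2 * (b ^ 2 - B) + 2 * k - t * (3 * b - A)) / (2 * t) := by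
      field_simp
      ring
    rw [this, le_div_iff₀ (by positivity), hkr, hn]
    nlinarith
  linarith

theorem tendsto_sqrt_add_sub_sqrt (v c : ℝ) (hv : 0 < v) :
    Tendsto (fun k : ℕ => √(v * (2 * k + c)) - √(2 * k * v)) atTop (nhds 0) := by
  have hden : Tendsto (fun k : ℕ => √(2 * (k : ℝ) * v)) atTop atTop :=
    Real.tendsto_sqrt_atTop.comp
      ((tendsto_natCast_atTop_atTop.const_mul_atTop two_pos).atTop_mul_const hv)
  have hlim : Tendsto (fun k : ℕ => |v * c| / √(2 * (k : ℝ) * v)) atTop (nhds 0) :=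
    hden.const_div_atTop _
  refine squeeze_zero_norm' ?_ hlim
  obtain ⟨K, hK⟩ := exists_nat_gt (|c|)
  filter_upwards [eventually_ge_atTop (K + 1)] with k hk
  have hkr : (K : ℝ) + 1 ≤ k := by exact_mod_cast hk
  have hc := neg_abs_le c
  have hc0 := abs_nonneg c
  have h1 : 0 ≤ v * (2 * k + c) := mul_nonneg hv.le (by linarith)
  have h2 : 0 < 2 * (k : ℝ) * v := mul_pos (by linarith) hv
  have hs := Real.sqrt_pos.2 h2
  have hs1 := Real.sqrt_nonneg (v * (2 * k + c))
  rw [Real.norm_eq_abs, le_div_iff₀ hs]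
  have hprod : (√(v * (2 * k + c)) - √(2 * k * v)) * (√(v * (2 * k + c)) + √(2 * k * v))
      = v * c := by
    have := Real.sq_sqrt h1
    have := Real.sq_sqrt h2.le
    nlinarith
  rw [← hprod, abs_mul, abs_of_nonneg (add_nonneg hs1 hs.le)]
  exact mul_le_mul_of_nonneg_left (by linarith) (abs_nonneg _)

theorem liminf_eq_of_eventually_frequently {f : ℕ → ℝ} {L : ℝ}
    (h1 : ∀ ε > 0, ∀ᶠ k in atTop, L - ε ≤ f k) (h2 : ∀ ε > 0, ∃ᶠ k in atTop, f k ≤ L + ε) :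
    liminf f atTop = L := by
  rw [liminf_eq]
  refine IsLUB.csSup_eq ⟨fun a ha => ?_, fun u hu => ?_⟩ ⟨L - 1, h1 1 one_pos⟩
  · refine le_of_forall_pos_le_add fun ε hε => ?_
    obtain ⟨k, hk, hk'⟩ := ((h2 ε hε).and_eventually ha).exists
    exact hk'.trans hk
  · refine le_of_forall_pos_le_add fun ε hε => ?_
    have := hu (h1 ε hε)
    linarith

/-- `liminf (c_k − √(2k·Vol)) = −Per/2` where `Vol = b² − ∑ bj²`
and `Per = 3b − ∑ bj`. -/
theorem stmt_3 (b : ℝ) (hb : 0 < b) (bj : ℕ → ℝ)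
    (hnonneg : ∀ j, 0 ≤ bj j) (hmono : Antitone bj) (hsum : Summable bj)
    (h12 : bj 0 + bj 1 ≤ b) (h3b : ∑' j, bj j ≤ 3 * b)
    (hsq : ∑' j, (bj j) ^ 2 < b ^ 2) :
    Filter.liminf
        (fun k : ℕ => toricCap b bj k -
          Real.sqrt (2 * k * (b ^ 2 - ∑' j, (bj j) ^ 2)))
        Filter.atTop
      = -(3 * b - ∑' j, bj j) / 2 := by
  have hs2 := summable_sq_of_antitone hnonneg hmono hsum
  have hv : 0 < b ^ 2 - ∑' j, bj j ^ 2 := by linarith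
  refine liminf_eq_of_eventually_frequently (fun ε hε => ?_) (fun ε hε => ?_)
  · obtain ⟨N, hN⟩ := (hsum.hasSum.tendsto_sum_nat.eventually
      (lt_mem_nhds (sub_lt_self (∑' j, bj j) hε))).exists
    filter_upwards [eventually_ge_atTop N,
      (tendsto_sqrt_add_sub_sqrt _ (9 / 4 - N / 4) hv).eventually
        (lt_mem_nhds (neg_lt_zero.2 (half_pos hε)))] with k hk hk2
    have := toricCap_ge hb hs2 hsq (k := k) (N := N) (by omega)
    rw [← add_sub_assoc] at hk2
    linarith
  · rw [frequently_atTop]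
    intro K
    set v := b ^ 2 - ∑' j, bj j ^ 2
    have ht : Tendsto (fun n : ℕ => (n : ℝ) / b) atTop atTop :=
      tendsto_natCast_atTop_atTop.atTop_div_const hb
    have hK : Tendsto (fun n : ℕ => ((n : ℝ) / b) ^ 2 * v) atTop atTop :=
      ((tendsto_pow_atTop two_ne_zero).comp ht).atTop_mul_const hv
    have herr : Tendsto (fun n : ℕ => (9 * b / 2) ^ 2 / (2 * ((n : ℝ) / b) * v)) atTop (nhds 0) :=
      ((ht.const_mul_atTop two_pos).atTop_mul_const hv).const_div_atTop _
    obtain ⟨n, hn1, hn2, hn3⟩ := ((hK.eventually_ge_atTop (2 * K)).and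
      ((herr.eventually (gt_mem_nhds hε)).and (eventually_gt_atTop 0))).exists
    have hn0 : (0 : ℝ) < n := Nat.cast_pos.2 hn3
    obtain ⟨k, hk1, hk2⟩ := exists_toricCap_sub_sqrt_le hb hnonneg hsum h3b hs2 hsq
      (t := n / b) (by positivity) (n := n) (by field_simp)
    refine ⟨k, ?_, by linarith⟩
    have : (K : ℝ) ≤ k := by linarith
    exact_mod_cast this
end

section
/- Let n ≥ 3 and let a_0, a_1, …, a_n be positive real numbers. For k ∈ ℕ define c_k(a_0; a_1,…,a_n) := inf{ d·a_0 − ∑_{i=1}^n d_i·a_i : d, d_1, …, d_n ∈ ℕ and d² + 3d − ∑_{i=1}^n (d_i² + d_i) ≥ 2k }. Assume the admissibility conditions: a_0² > ∑_{i=1}^n a_i², and for every k ∈ ℕ, max{∑_{i=1}^n cB(a_i, k_i) : k_i ∈ ℕ, ∑ k_i = k} ≤ cB(a_0, k), where cB(a,k) := a · min{d ∈ ℕ : d² + 3d ≥ 2k}. Let 𝒞(a_0; a_1,…,a_n) := (a_0 + δ; a_1 + δ, a_2 + δ, a_3 + δ, a_4, …, a_n) with δ := a_0 − a_1 − a_2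 − a_3 be the Cremona transform. Then for every k ∈ ℕ, c_k(a_0; a_1,…,a_n) = c_k(𝒞(a_0; a_1,…,a_n)). -/
/-- The `k`-th ECH capacity of the tuple `(a0; a 0, …, a (n-1))`:
`inf { d·a0 − ∑ dᵢ·aᵢ | d, dᵢ ∈ ℕ, d² + 3d − ∑ (dᵢ² + dᵢ) ≥ 2k }`. -/
noncomputable def tupleCap (n : ℕ) (a0 : ℝ) (a : Fin n → ℝ) (k : ℕ) : ℝ :=
  sInf {x : ℝ | ∃ (d : ℕ) (dv : Fin n → ℕ),
    (2 * k : ℤ) ≤ (d : ℤ) ^ 2 + 3 * (d : ℤ) - ∑ i, ((dv i : ℤ) ^ 2 + (dv i : ℤ)) ∧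
    x = (d : ℝ) * a0 - ∑ i, (dv i : ℝ) * a i}

/-- A class with nonnegative degree and arbitrary integer multiplicities can be replaced by one
with nonnegative multiplicities, of the same index and no larger action. -/
theorem exists_nat_multiplicities_le {n : ℕ} {a0 : ℝ} {a : Fin n → ℝ} (ha : ∀ i, 0 ≤ a i)
    (k : ℕ) (d : ℤ) (hd : 0 ≤ d) (e : Fin n → ℤ)
    (h : (2 * k : ℤ) ≤ d ^ 2 + 3 * d - ∑ i, (e i ^ 2 + e i)) :
    ∃ y ∈ {x : ℝ | ∃ (d : ℕ) (dv : Fin n → ℕ),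
      (2 * k : ℤ) ≤ (d : ℤ) ^ 2 + 3 * (d : ℤ) - ∑ i, ((dv i : ℤ) ^ 2 + (dv i : ℤ)) ∧
      x = (d : ℝ) * a0 - ∑ i, (dv i : ℝ) * a i},
      y ≤ (d : ℝ) * a0 - ∑ i, (e i : ℝ) * a i := by
  lift d to ℕ using hd
  have hreflect (z : ℤ) : ∃ m : ℕ, (m : ℤ) ^ 2 + m = z ^ 2 + z ∧ z ≤ m := by
    rcases le_or_gt 0 z with hz | hz
    · lift z to ℕ using hz
      exact ⟨z, rfl, le_rfl⟩
    · obtain ⟨m, hm⟩ := Int.eq_ofNat_of_zero_le (show 0 ≤ -1 - z by omega)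
      refine ⟨m, ?_, by omega⟩
      rw [← hm]
      ring
  choose f hf hle using fun i => hreflect (e i)
  refine ⟨_, ⟨d, f, ?_, rfl⟩, ?_⟩
  · simpa only [hf] using h
  · push_cast
    gcongr with i
    · exact ha i
    · exact_mod_cast hle i

/-- Every class admissible for `a` yields, via the Cremona transform, a class admissible for the
transformed tuple with no larger action. -/
theorem exists_cremona_le {m : ℕ} {a0 b0 δ : ℝ} {a b : Fin (m + 3) → ℝ}
    (hb : ∀ i, 0 ≤ b i) (hδ : δ = a0 - a 0 - a 1 - a 2) (hb0 : b0 = a0 + δ)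
    (hbi : ∀ i, b i = if (i : ℕ) < 3 then a i + δ else a i) (k : ℕ) :
    ∀ x ∈ {x : ℝ | ∃ (d : ℕ) (dv : Fin (m + 3) → ℕ),
      (2 * k : ℤ) ≤ (d : ℤ) ^ 2 + 3 * (d : ℤ) - ∑ i, ((dv i : ℤ) ^ 2 + (dv i : ℤ)) ∧
      x = (d : ℝ) * a0 - ∑ i, (dv i : ℝ) * a i},
    ∃ y ∈ {x : ℝ | ∃ (d : ℕ) (dv : Fin (m + 3) → ℕ),
      (2 * k : ℤ) ≤ (d : ℤ) ^ 2 + 3 * (d : ℤ) - ∑ i, ((dv i : ℤ) ^ 2 + (dv i : ℤ)) ∧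
      x = (d : ℝ) * b0 - ∑ i, (dv i : ℝ) * b i}, y ≤ x := by
  rintro x ⟨d, v, hv, rfl⟩
  have hsplit {R : Type} [AddCommMonoid R] (f : Fin (m + 3) → R) :
      ∑ i, f i = f 0 + (f 1 + (f 2 + ∑ i : Fin m, f i.succ.succ.succ)) := by
    simp only [Fin.sum_univ_succ]
    rfl
  set c : ℤ := d - v 0 - v 1 - v 2 with hc
  rw [hsplit] at hv
  have hrest : (0 : ℤ) ≤ ∑ i : Fin m,
      ((v i.succ.succ.succ : ℤ) ^ 2 + (v i.succ.succ.succ : ℤ)) :=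
    Finset.sum_nonneg fun i _ => by positivity
  have hdeg : 0 ≤ (d : ℤ) + c := by
    by_contra! hneg
    have hk : (0 : ℤ) ≤ k := Int.natCast_nonneg k
    have hd : (0 : ℤ) ≤ d := Int.natCast_nonneg d
    have hs : 2 * (d : ℤ) + 1 ≤ v 0 + v 1 + v 2 := by omega
    nlinarith [sq_nonneg ((v 0 : ℤ) - v 1), sq_nonneg ((v 0 : ℤ) - v 2),
      sq_nonneg ((v 1 : ℤ) - v 2)]
  have h2 : 2 % (m + 3) = 2 := Nat.mod_eq_of_lt (by omega)
  have hge (x : ℕ) : ¬ x + 1 + 1 + 1 < 3 := by omega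
  obtain ⟨y, hy, hle⟩ := exists_nat_multiplicities_le (a0 := b0) hb k (d + c) hdeg
    (fun i => if (i : ℕ) < 3 then v i + c else v i) (by
      rw [hsplit]
      simp [h2, hge]
      rw [hc]
      linarith)
  refine ⟨y, hy, hle.trans_eq ?_⟩
  rw [hsplit, hsplit]
  simp [h2, hge, hbi, hb0]
  rw [hc, hδ]
  push_cast
  ring

/-- Two balls in an admissible tuple satisfy the two-ball packing inequality. -/
theorem add_le_of_cB_sum_le {n : ℕ} {a0 : ℝ} {a : Fin n → ℝ}
    (hadm : ∀ k : ℕ, ∀ κ : Fin n → ℕ, (∑ i, κ i) = k → (∑ i, cB (a i) (κ i)) ≤ cB a0 k)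
    {i j : Fin n} (hij : i ≠ j) : a i + a j ≤ a0 := by
  have hzero (x : ℝ) : cB x 0 = 0 := by simp [cB]
  have hone (x : ℝ) (k : ℕ) (hk : 0 < k) (hk2 : k ≤ 2) : cB x k = x := by
    have : sInf {d : ℕ | 2 * k ≤ d ^ 2 + 3 * d} = 1 := by
      refine IsLeast.csInf_eq ⟨by simp; omega, fun d hd => ?_⟩
      rcases Nat.eq_zero_or_pos d with rfl | h
      · simp at hd
        omega
      · exact h
    simp [cB, this]
  have h := hadm 2 (fun l => if l = i ∨ l = j then 1 else 0) (by
    rw [Finset.sum_eq_add i j hij] <;> simp +contextual)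
  rw [Finset.sum_eq_add i j hij (by simp +contextual [hzero]) (by simp) (by simp)] at h
  simpa [hone] using h

/-- the ECH capacities of an admissible tuple `(a0; a 0, …, a (n-1))`
agree with those of its Cremona transform
`(a0 + δ; a 0 + δ, a 1 + δ, a 2 + δ, a 3, …)` where `δ = a0 − a 0 − a 1 − a 2`. -/
theorem stmt_7 (n : ℕ) (hn : 3 ≤ n) (a0 : ℝ) (a : Fin n → ℝ)
    (ha0 : 0 < a0) (ha : ∀ i, 0 < a i)
    (hvol : (∑ i, (a i) ^ 2) < a0 ^ 2)
    (hadm : ∀ k : ℕ, ∀ κ : Fin n → ℕ, (∑ i, κ i) = k →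
      (∑ i, cB (a i) (κ i)) ≤ cB a0 k)
    (δ : ℝ) (hδ : δ = a0 - a ⟨0, by omega⟩ - a ⟨1, by omega⟩ - a ⟨2, by omega⟩) :
    ∀ k : ℕ, tupleCap n a0 a k =
      tupleCap n (a0 + δ) (fun i => if (i : ℕ) < 3 then a i + δ else a i) k := by
  intro k
  obtain ⟨m, rfl⟩ : ∃ m, n = m + 3 := ⟨n - 3, by omega⟩
  change δ = a0 - a 0 - a 1 - a 2 at hδ
  have h01 : a 0 + a 1 ≤ a0 := add_le_of_cB_sum_le hadm (by simp)
  have h02 : a 0 + a 2 ≤ a0 := add_le_of_cB_sum_le hadm (by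
    intro h
    exact absurd (congrArg Fin.val h) (by change ¬ (0 = 2); omega))
  have h12 : a 1 + a 2 ≤ a0 := add_le_of_cB_sum_le hadm (by
    intro h
    exact absurd (congrArg Fin.val h) (by change ¬ (1 = 2); omega))
  have h2 : 2 % (m + 3) = 2 := Nat.mod_eq_of_lt (by omega)
  refine csInf_eq_csInf_of_forall_exists_le
    (exists_cremona_le (δ := δ) (fun i => ?_) hδ rfl (fun _ => rfl) k)
    (exists_cremona_le (δ := -δ) (fun i => (ha i).le) ?_ (by ring) (fun i => ?_) k)
  · split_ifs with hi
    · obtain ⟨i, hlt⟩ := i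
      simp only at hi
      interval_cases i
      · change 0 ≤ a 0 + δ
        linarith
      · change 0 ≤ a 1 + δ
        linarith
      · change 0 ≤ a 2 + δ
        linarith
    · exact (ha i).le
  · simp [h2]
    linarith
  · split_ifs <;> ring
end

section
/- Let N ∈ ℕ and suppose (d_0, m_0, p_0, q_0) and (d_1, m_1, p_1, q_1), with d_i, p_i, q_i ∈ ℤ and m_i : Fin N → ℤ, are quasi-perfect: 3d_i = ∑_j m_i(j) + p_i + q_i and d_i² − ∑_j m_i(j)² = p_i·q_i − 1 for i = 0,1. Assume they are adjacent: d_0·d_1 − ∑_j m_0(j)·m_1(j) = p_1·q_0, and set t := p_0·q_1 − p_1·q_0 with t > 0. Define sequences by the recursion x_{k+1} = t·x_k − x_{k−1} applied to each of d, p, q and each component of m. Then for every k ≥ 0: (i) 3d_k = ∑_j m_k(j) + p_k + q_k; (ii) d_k² − ∑_j m_k(j)² = p_k·q_k − 1; (iii) d_k·d_{k+1} − ∑_j m_k(j)·m_{k+1}(j) = p_{k+1}·q_k (consecutive terms are adjacent); and (iv) p_{k+1}·q_k − p_k·q_{k+1} = −t. -/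
/-- recursively generated quasi-perfect classes. Given two adjacent
quasi-perfect seeds and the recursion `x_{k+1} = t·x_k − x_{k−1}` with
`t = p₀q₁ − p₁q₀ > 0`, all the resulting classes are quasi-perfect, consecutive
classes are adjacent, and `p_{k+1}·q_k − p_k·q_{k+1} = −t`. -/
theorem stmt_10 (N : ℕ) (d p q : ℕ → ℤ) (m : ℕ → Fin N → ℤ) (t : ℤ)
    (ht : t = p 0 * q 1 - p 1 * q 0) (htpos : 0 < t)
    (hqp0 : 3 * d 0 = (∑ j, m 0 j) + p 0 + q 0 ∧
      (d 0) ^ 2 - ∑ j, (m 0 j) ^ 2 = p 0 * q 0 - 1)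
    (hqp1 : 3 * d 1 = (∑ j, m 1 j) + p 1 + q 1 ∧
      (d 1) ^ 2 - ∑ j, (m 1 j) ^ 2 = p 1 * q 1 - 1)
    (hadj : d 0 * d 1 - (∑ j, m 0 j * m 1 j) = p 1 * q 0)
    (hrecd : ∀ k, d (k + 2) = t * d (k + 1) - d k)
    (hrecp : ∀ k, p (k + 2) = t * p (k + 1) - p k)
    (hrecq : ∀ k, q (k + 2) = t * q (k + 1) - q k)
    (hrecm : ∀ k, ∀ j, m (k + 2) j = t * m (k + 1) j - m k j) :
    ∀ k : ℕ,
      (3 * d k = (∑ j, m k j) + p k + q k) ∧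
      ((d k) ^ 2 - ∑ j, (m k j) ^ 2 = p k * q k - 1) ∧
      (d k * d (k + 1) - (∑ j, m k j * m (k + 1) j) = p (k + 1) * q k) ∧
      (p (k + 1) * q k - p k * q (k + 1) = -t) := by
  suffices h : ∀ k : ℕ,
      (3 * d k = (∑ j, m k j) + p k + q k) ∧
      (3 * d (k + 1) = (∑ j, m (k + 1) j) + p (k + 1) + q (k + 1)) ∧
      ((d k) ^ 2 - ∑ j, (m k j) ^ 2 = p k * q k - 1) ∧
      ((d (k + 1)) ^ 2 - ∑ j, (m (k + 1) j) ^ 2 = p (k + 1) * q (k + 1) - 1) ∧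
      (d k * d (k + 1) - (∑ j, m k j * m (k + 1) j) = p (k + 1) * q k) ∧
      (p (k + 1) * q k - p k * q (k + 1) = -t) by
    intro k
    obtain ⟨hlin, -, hsq, -, hmul, hdet⟩ := h k
    exact ⟨hlin, hsq, hmul, hdet⟩
  intro k
  induction k with
  | zero => exact ⟨hqp0.1, hqp1.1, hqp0.2, hqp1.2, hadj, by rw [ht]; ring⟩
  | succ k ih =>
    obtain ⟨hlin, hlin', hsq, hsq', hmul, hdet⟩ := ih
    have hsum : ∑ j, m (k + 2) j = t * (∑ j, m (k + 1) j) - ∑ j, m k j := by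
      simp only [hrecm, Finset.mul_sum, ← Finset.sum_sub_distrib]
    have hsum_sq : ∑ j, (m (k + 2) j) ^ 2 = t ^ 2 * (∑ j, (m (k + 1) j) ^ 2)
        - 2 * t * (∑ j, m k j * m (k + 1) j) + ∑ j, (m k j) ^ 2 := by
      simp only [hrecm, Finset.mul_sum, ← Finset.sum_sub_distrib, ← Finset.sum_add_distrib]
      exact Finset.sum_congr rfl fun j _ => by ring
    have hsum_mul : ∑ j, m (k + 1) j * m (k + 2) j
        = t * (∑ j, (m (k + 1) j) ^ 2) - ∑ j, m k j * m (k + 1) j := by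
      simp only [hrecm, Finset.mul_sum, ← Finset.sum_sub_distrib]
      exact Finset.sum_congr rfl fun j _ => by ring
    simp only [add_assoc, Nat.reduceAdd] at *
    refine ⟨hlin', ?_, hsq', ?_, ?_, ?_⟩
    · rw [hsum, hrecd, hrecp, hrecq]
      linear_combination t * hlin' - hlin
    · rw [hsum_sq, hrecd, hrecp, hrecq]
      linear_combination t ^ 2 * hsq' + hsq - 2 * t * hmul - t * hdet
    · rw [hsum_mul, hrecd, hrecp]
      linear_combination t * hsq' - hmul - hdet
    · rw [hrecp, hrecq]
      linear_combination hdet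
end

section
/- Let N be a positive integer, let b, m̃ ∈ ℝ^N with b ≠ 0 and ‖b‖ ≤ 1, let d ∈ ℝ, and set M := ⟪m̃, b⟫/‖b‖². If (d − ⟪m̃, b⟫)² ≤ (1 − ‖b‖²)·(d² − ‖m̃‖² + 1), then (M − d)² ≤ 1/‖b‖² − 1. -/
open scoped RealInnerProductSpace

/-- if `b ≠ 0`, `‖b‖ ≤ 1`, `M = ⟪m̃,b⟫/‖b‖²`, and
`(d − ⟪m̃,b⟫)² ≤ (1 − ‖b‖²)(d² − ‖m̃‖² + 1)`, then `(M − d)² ≤ 1/‖b‖² − 1`. -/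
theorem stmt_17 (N : ℕ) (hN : 0 < N)
    (b mt : EuclideanSpace ℝ (Fin N)) (hb : b ≠ 0) (hb1 : ‖b‖ ≤ 1) (d : ℝ)
    (h : (d - ⟪mt, b⟫) ^ 2 ≤ (1 - ‖b‖ ^ 2) * (d ^ 2 - ‖mt‖ ^ 2 + 1)) :
    (⟪mt, b⟫ / ‖b‖ ^ 2 - d) ^ 2 ≤ 1 / ‖b‖ ^ 2 - 1 := by
  have hB : 0 < ‖b‖ ^ 2 := by positivity
  have hcs : ⟪mt, b⟫ ^ 2 ≤ ‖mt‖ ^ 2 * ‖b‖ ^ 2 := by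
    rw [← mul_pow, ← sq_abs]
    gcongr
    exact abs_real_inner_le_norm mt b
  have hB1 : 0 ≤ 1 - ‖b‖ ^ 2 := sub_nonneg.2 (pow_le_one₀ (norm_nonneg b) hb1)
  obtain ⟨M, hM⟩ : ∃ M : ℝ, ⟪mt, b⟫ = M * ‖b‖ ^ 2 :=
    ⟨⟪mt, b⟫ / ‖b‖ ^ 2, (div_mul_cancel₀ _ hB.ne').symm⟩
  rw [hM] at h hcs ⊢
  rw [mul_div_cancel_right₀ _ hB.ne']
  have hmt : M ^ 2 * ‖b‖ ^ 2 ≤ ‖mt‖ ^ 2 :=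
    le_of_mul_le_mul_right (by linarith) hB
  rw [le_sub_iff_add_le, le_div_iff₀ hB]
  linarith [mul_le_mul_of_nonneg_left hmt hB1]
end

section
/- Let Vol, d, Per, a_0 be real numbers with Vol > 0, d > 0, d² ≤ Vol, 0 ≤ Per < d + Vol/d, a_0 ≥ 1, and a_0² − (Per²/Vol − 2)·a_0 + 1 = 0 (equivalently 1/a_0 + a_0 + 2 = Per²/Vol). Then d²·a_0 < Vol. -/
/-- if the Gromov-width bound `d` satisfies `d² ≤ Vol`,
`0 ≤ Per < d + Vol/d`, and `a₀ ≥ 1` is the accumulation point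
(`a₀² − (Per²/Vol − 2)·a₀ + 1 = 0`), then `d²·a₀ < Vol`. -/
theorem stmt_18 (Vol d Per a0 : ℝ) (hVol : 0 < Vol) (hd : 0 < d)
    (hdVol : d ^ 2 ≤ Vol) (hPer0 : 0 ≤ Per) (hPer : Per < d + Vol / d)
    (ha0 : 1 ≤ a0)
    (heq : a0 ^ 2 - (Per ^ 2 / Vol - 2) * a0 + 1 = 0) :
    d ^ 2 * a0 < Vol := by
  have hquad : Vol * (a0 + 1) ^ 2 = Per ^ 2 * a0 := by
    field_simp at heq
    linarith
  have hlin : Per * d < d ^ 2 + Vol := by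
    calc Per * d < (d + Vol / d) * d := by gcongr
      _ = d ^ 2 + Vol := by field_simp
  have hsq : (Per * d) ^ 2 < (d ^ 2 + Vol) ^ 2 := by gcongr
  have hfactor : 0 < (Vol - d ^ 2 * a0) * (a0 * Vol - d ^ 2) := by
    calc 0 < a0 * ((d ^ 2 + Vol) ^ 2 - (Per * d) ^ 2) :=
          mul_pos (by linarith) (sub_pos.mpr hsq)
      _ = (Vol - d ^ 2 * a0) * (a0 * Vol - d ^ 2) := by
          linear_combination d ^ 2 * hquad
  have hnonneg : 0 ≤ a0 * Vol - d ^ 2 := by nlinarith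
  exact sub_pos.mp (pos_of_mul_pos_left hfactor hnonneg)
end

section
/- Fix n ∈ ℕ. Define integer sequences d_k, p_k, q_k by d_0 = 2, p_0 = 3, q_0 = 1, d_1 = 22 + 10n, p_1 = 22 + 10n, q_1 = 9 + 4n, each satisfying the recursion x_{k+1} = (2n + 5)·x_k − x_{k−1}. Let β := 1/(17 + 8n + √((3 + 2n)(7 + 2n))), Vol := 1/2 − β²·(45 + 10n² + 42n), and for each k set S_k := d_k/2 + β·(d_k·(5 + 3n) − (5 + 2n)·p_k + 5·q_k). Then for every k ≥ 0: p_k·q_k·Vol > (d_k − S_k)². -/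
/-- Binet-type closed form for `x (k+2) = (l + m) x (k+1) - x k` with `l * m = 1`. -/
theorem sub_mul_eq_of_recurrence {l m : ℝ} (hlm : l * m = 1) {x : ℕ → ℝ}
    (hx : ∀ k, x (k + 2) = (l + m) * x (k + 1) - x k) (k : ℕ) :
    (l - m) * x k = (x 1 - m * x 0) * l ^ k + (l * x 0 - x 1) * m ^ k := by
  induction k using Nat.twoStepInduction with
  | zero => ring
  | one => ring
  | more k ih₀ ih₁ =>
    rw [hx k]
    linear_combination (l + m) * ih₁ - ih₀ +
      ((x 1 - m * x 0) * l ^ k + (l * x 0 - x 1) * m ^ k) * hlm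

/-- each class `𝔼_k(n)` is obstructive at its center: with
`β = 1/(17+8n+√((3+2n)(7+2n)))`, `Vol = 1/2 − β²(45+10n²+42n)` and
`S_k = d_k/2 + β(d_k(5+3n) − (5+2n)p_k + 5q_k)`, we have
`p_k·q_k·Vol > (d_k − S_k)²` for all `k`. -/
theorem stmt_19 (n : ℕ) (d p q : ℕ → ℤ)
    (hd0 : d 0 = 2) (hp0 : p 0 = 3) (hq0 : q 0 = 1)
    (hd1 : d 1 = 22 + 10 * n) (hp1 : p 1 = 22 + 10 * n) (hq1 : q 1 = 9 + 4 * n)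
    (hrecd : ∀ k, d (k + 2) = (2 * n + 5) * d (k + 1) - d k)
    (hrecp : ∀ k, p (k + 2) = (2 * n + 5) * p (k + 1) - p k)
    (hrecq : ∀ k, q (k + 2) = (2 * n + 5) * q (k + 1) - q k)
    (β : ℝ)
    (hβ : β = 1 / (17 + 8 * n + Real.sqrt ((3 + 2 * n) * (7 + 2 * n))))
    (Vol : ℝ) (hVol : Vol = 1 / 2 - β ^ 2 * (45 + 10 * (n : ℝ) ^ 2 + 42 * n))
    (S : ℕ → ℝ)
    (hS : ∀ k, S k = (d k : ℝ) / 2 +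
      β * ((d k : ℝ) * (5 + 3 * n) - (5 + 2 * (n : ℝ)) * (p k : ℝ) + 5 * (q k : ℝ))) :
    ∀ k : ℕ, ((d k : ℝ) - S k) ^ 2 < (p k : ℝ) * (q k : ℝ) * Vol := by
  intro k
  set s : ℝ := Real.sqrt ((3 + 2 * n) * (7 + 2 * n))
  have hn : (0 : ℝ) ≤ n := n.cast_nonneg
  have hs2 : s ^ 2 = (3 + 2 * n) * (7 + 2 * n) := Real.sq_sqrt (by positivity)
  have hs_lower : 2 * (n : ℝ) + 4 ≤ s := Real.le_sqrt_of_sq_le (by nlinarith)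
  obtain ⟨l, hl⟩ : ∃ l : ℝ, l = (2 * n + 5 + s) / 2 := ⟨_, rfl⟩
  obtain ⟨m, hm⟩ : ∃ m : ℝ, m = (2 * n + 5 - s) / 2 := ⟨_, rfl⟩
  have hlm : l * m = 1 := by rw [hl, hm]; linear_combination -hs2 / 4
  have hsum : l + m = 2 * n + 5 := by rw [hl, hm]; ring
  have hl0 : 0 < l := by rw [hl]; linarith
  have hm0 : 0 < m := pos_of_mul_pos_right (hlm ▸ one_pos) hl0.le
  have hm1 : m ≤ 1 := by rw [hm]; linarith
  have hsl : s = l - m := by rw [hl, hm]; ring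
  have hVol_upper : 2 * Vol ≤ 1 := by
    have : 0 ≤ β ^ 2 * (45 + 10 * (n : ℝ) ^ 2 + 42 * n) := by positivity
    linarith
  have hVol_lower : 1 < 3 * Vol := by
    have hw : 0 < 17 + 8 * (n : ℝ) + s := by linarith
    have : β ^ 2 * (45 + 10 * (n : ℝ) ^ 2 + 42 * n) < 1 / 6 := by
      rw [hβ, div_pow, one_pow, one_div_mul_eq_div, div_lt_iff₀ (by positivity)]
      nlinarith
    linarith
  have hd (k) : (d (k + 2) : ℝ) = (l + m) * d (k + 1) - d k := by
    rw [hsum]; exact_mod_cast hrecd k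
  have hp (k) : (p (k + 2) : ℝ) = (l + m) * p (k + 1) - p k := by
    rw [hsum]; exact_mod_cast hrecp k
  have hq (k) : (q (k + 2) : ℝ) = (l + m) * q (k + 1) - q k := by
    rw [hsum]; exact_mod_cast hrecq k
  have hS' (k) : (d (k + 2) : ℝ) - S (k + 2) =
      (l + m) * (d (k + 1) - S (k + 1)) - (d k - S k) := by
    rw [hS, hS, hS, hd, hp, hq]; ring
  have key : (p k : ℝ) * q k * Vol - (d k - S k) ^ 2 = Vol - (1 - 2 * Vol) * (m ^ k) ^ 2 := by
    have ep := sub_mul_eq_of_recurrence hlm (x := fun k ↦ (p k : ℝ)) hp k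
    have eq := sub_mul_eq_of_recurrence hlm (x := fun k ↦ (q k : ℝ)) hq k
    have ee := sub_mul_eq_of_recurrence hlm (x := fun k ↦ (d k : ℝ) - S k) hS' k
    simp only [hS 0, hS 1, hd0, hd1, hp0, hp1, hq0, hq1] at ep eq ee
    push_cast at ep eq ee
    have huv : l ^ k * m ^ k = 1 := by rw [← mul_pow, hlm, one_pow]
    have hnl : (n : ℝ) = (l + m - 5) / 2 := by linarith
    have hml : m = 1 / l := by field_simp; linarith
    obtain ⟨w, hw⟩ : ∃ w : ℝ, w = 5 * l ^ 2 - 3 * l + 3 := ⟨_, rfl⟩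
    have hw0 : w ≠ 0 := by nlinarith [sq_nonneg (l - 1)]
    have hβl : β = l / w := by
      have hw' : 17 + 8 * (n : ℝ) + s = w / l := by
        rw [hnl, hsl, hml, hw]; field_simp; ring
      rw [hβ, hw', one_div_div]
    have hlm_ne : l - m ≠ 0 := by rw [← hsl]; linarith
    refine mul_left_cancel₀ (pow_ne_zero 2 hlm_ne) ?_
    calc (l - m) ^ 2 * ((p k : ℝ) * q k * Vol - (d k - S k) ^ 2)
        = ((l - m) * p k) * ((l - m) * q k) * Vol - ((l - m) * (d k - S k)) ^ 2 := by ring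
      _ = (l - m) ^ 2 * (Vol * (l ^ k * m ^ k) - (1 - 2 * Vol) * (m ^ k) ^ 2) := by
        rw [ep, eq, ee, hVol]
        generalize l ^ k = u
        generalize m ^ k = v
        rw [hβl, hnl, hml]
        field_simp
        rw [hw]
        ring
      _ = _ := by rw [huv, mul_one]
  have hv0 : 0 ≤ m ^ k := by positivity
  have hv1 : m ^ k ≤ 1 := pow_le_one₀ hm0.le hm1
  nlinarith [mul_nonneg (sub_nonneg.2 hVol_upper) (sub_nonneg.2 (pow_le_one₀ hv0 hv1 (n := 2)))]
end
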